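/- Let n ≥ 1 and let λ be a B-partition of n. Let μ(λ), ν(λ) = λ^t ∖ μ(λ) and d(λ) = ((λ^t)^−)_C be as defined. Then d(λ) = μ(λ) ∪ ((ν(λ))^−)_C, i.e. the C-collapse of (λ^t)^− equals the union of μ(λ) with the C-collapse of (ν(λ))^−. (Note |ν(λ)| is odd, so ν(λ) is nonempty and (ν(λ))^− is a partition of an even number.) -/

import Mathlib

namespace WFPaper

/-- The list of parts of a partition (multiset of positive integers) in weakly
decreasing order. -/
def sortedDesc (s : Multiset ℕ) : List ℕ := (s.sort (· ≤ ·)).reverse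

/-- The `j`-th largest part of `s` (1-indexed); `0` if `j = 0` or `j > #s`. -/
def part (s : Multiset ℕ) (j : ℕ) : ℕ := (sortedDesc s).getD (j - 1) 0

/-- The smallest part of `s` (`0` if `s` is empty). -/
def minPart (s : Multiset ℕ) : ℕ := (s.sort (· ≤ ·)).getD 0 0

/-- Sum of the `j` largest parts of `s`. -/
def psum (s : Multiset ℕ) (j : ℕ) : ℕ := ((sortedDesc s).take j).sum

/-- Dominance order: `DomLE a b` means `a ≤ b` in the dominance order, i.e.
for every `j` the sum of the `j` largest parts of `a` is at most that of `b`. -/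
def DomLE (a b : Multiset ℕ) : Prop := ∀ j, psum a j ≤ psum b j

/-- All parts are positive. -/
def PosParts (s : Multiset ℕ) : Prop := ∀ x ∈ s, 0 < x

/-- A partition of an odd number in which every even part has even multiplicity
(a B-partition of `n` when the sum is `2*n+1`). -/
def IsTypeB (s : Multiset ℕ) : Prop :=
  PosParts s ∧ Odd s.sum ∧ ∀ x, Even x → Even (s.count x)

/-- A partition of an even number in which every odd part has even multiplicity
(a C-partition of `n` when the sum is `2*n`). -/
def IsTypeC (s : Multiset ℕ) : Prop :=
  PosParts s ∧ Even s.sum ∧ ∀ x, Odd x → Even (s.count x)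

/-- A partition of an even number in which every even part has even multiplicity
(a D-partition of `n` when the sum is `2*n`). -/
def IsTypeD (s : Multiset ℕ) : Prop :=
  PosParts s ∧ Even s.sum ∧ ∀ x, Even x → Even (s.count x)

/-- `IsCollapse T α β` : `β` is the dominance-largest partition of class `T` of
the same number as `α` which is dominated by `α` (e.g. the B/C/D-collapse of `α`
for `T = IsTypeB/IsTypeC/IsTypeD`). -/
def IsCollapse (T : Multiset ℕ → Prop) (α β : Multiset ℕ) : Prop :=
  T β ∧ β.sum = α.sum ∧ DomLE β α ∧
    ∀ γ, T γ → γ.sum = α.sum → DomLE γ α → DomLE γ β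

/-- The transpose (conjugate) partition: its `j`-th part (0-indexed `j`) is the
number of parts of `s` that are `≥ j+1`. -/
def transpose (s : Multiset ℕ) : Multiset ℕ :=
  (Multiset.range (part s 1)).map (fun j => (s.filter (fun x => j + 1 ≤ x)).card)

/-- `λ⁻` : subtract 1 from the smallest part (the part being deleted if it
becomes 0). -/
def decMin (s : Multiset ℕ) : Multiset ℕ :=
  ((minPart s - 1) ::ₘ s.erase (minPart s)).filter (fun x => 0 < x)

/-- `λ⁺` : add 1 to the largest part. -/
def incMax (s : Multiset ℕ) : Multiset ℕ :=
  (part s 1 + 1) ::ₘ s.erase (part s 1)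

/-- The subpartition `μ` of `T` whose multiplicity at an even `x` is 2 if
`m_T(x)` is even and nonzero, 1 if `m_T(x)` is odd, and 0 at odd `x`. -/
def muEven (T : Multiset ℕ) : Multiset ℕ :=
  (T.toFinset.filter (fun x => Even x)).val.bind
    (fun x => Multiset.replicate (if Even (T.count x) then 2 else 1) x)

/-- The subpartition `μ` of `T` whose multiplicity at an odd `x` is 2 if
`m_T(x)` is even and nonzero, 1 if `m_T(x)` is odd, and 0 at even `x`. -/
def muOdd (T : Multiset ℕ) : Multiset ℕ :=
  (T.toFinset.filter (fun x => Odd x)).val.bind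
    (fun x => Multiset.replicate (if Even (T.count x) then 2 else 1) x)

/-- The subpartition `π` of `T` consisting of the even parts of `T` of odd
multiplicity, each taken once. -/
def piEven (T : Multiset ℕ) : Multiset ℕ :=
  (T.toFinset.filter (fun x => Even x ∧ Odd (T.count x))).val

/-- `k` is a (1-indexed) position of an odd part of `s`. -/
def OddIdx (s : Multiset ℕ) (k : ℕ) : Prop := 1 ≤ k ∧ Odd (part s k)

/-- `k` is a (1-indexed) position of an even part of `s`. -/
def EvenIdx (s : Multiset ℕ) (k : ℕ) : Prop :=
  1 ≤ k ∧ k ≤ Multiset.card s ∧ Even (part s k)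

/-- `e_s(i,j)` : number of positions `i ≤ k ≤ j` with `s_k` even. -/
def eCount (s : Multiset ℕ) (i j : ℕ) : ℕ :=
  ((Finset.Icc i j).filter (fun k => Even (part s k))).card

/-- number of positions `i ≤ k ≤ j` with `s_k` odd. -/
def oCount (s : Multiset ℕ) (i j : ℕ) : ℕ :=
  ((Finset.Icc i j).filter (fun k => Odd (part s k))).card

/-- `s` is special in the e-count sense: `e_s(1,t₁)` is even, and
`e_s(tᵢ,tᵢ₊₁)` is even for all `1 ≤ i ≤ p-1`, where `t₁ < ⋯ < t_p` are the
positions of the odd parts of `s`. -/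
def IsSpecialE (s : Multiset ℕ) : Prop :=
  (∀ t, OddIdx s t → (∀ t', OddIdx s t' → t ≤ t') → Even (eCount s 1 t)) ∧
  (∀ i j, OddIdx s i → OddIdx s j → i < j →
    (∀ k, OddIdx s k → k ≤ i ∨ j ≤ k) → Even (eCount s i j))

/-- `s` is quasi-special: `e_s(1,t₁)` is even, `e_s(tᵢ,tᵢ₊₁)` is even for all
`1 ≤ i ≤ p-2`, and the smallest part of `s` is odd with multiplicity 1. -/
def IsQuasiSpecialE (s : Multiset ℕ) : Prop :=
  (∀ t, OddIdx s t → (∀ t', OddIdx s t' → t ≤ t') → Even (eCount s 1 t)) ∧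
  (∀ i j, OddIdx s i → OddIdx s j → i < j →
    (∀ k, OddIdx s k → k ≤ i ∨ j ≤ k) → (∃ k, OddIdx s k ∧ j < k) →
      Even (eCount s i j)) ∧
  Odd (minPart s) ∧ s.count (minPart s) = 1

/-- Number of odd parts greater than every even part (equals the number of odd
parts greater than the largest even part, and the number of all odd parts if
there are no even parts). -/
def numOddDominant (s : Multiset ℕ) : ℕ :=
  (s.filter (fun x => Odd x ∧ ∀ y ∈ s, Even y → y < x)).card

/-- Between every pair of consecutive even parts of `s` (in the decreasing
listing of the parts) there is an even number of odd parts. -/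
def EvenBetween (s : Multiset ℕ) : Prop :=
  ∀ i j, EvenIdx s i → EvenIdx s j → i < j →
    (∀ k, EvenIdx s k → k ≤ i ∨ j ≤ k) → Even (oCount s i j)

/-- A special B-partition. -/
def IsSpecialTypeB (s : Multiset ℕ) : Prop :=
  IsTypeB s ∧ EvenBetween s ∧ Odd (numOddDominant s)

/-- A special D-partition. -/
def IsSpecialTypeD (s : Multiset ℕ) : Prop :=
  IsTypeD s ∧ EvenBetween s ∧ Even (numOddDominant s)

/-- The sum of the excesses of the parts of `s` over `t`. For partitions of the same number,
pointwise comparison of this function is the dominance order (`domLE_iff_excess_le`). -/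
def excess (s : Multiset ℕ) (t : ℕ) : ℕ := (s.map (fun x => x - t)).sum

@[simp] lemma excess_zero (t : ℕ) : excess 0 t = 0 := rfl

@[simp] lemma excess_cons (x : ℕ) (s : Multiset ℕ) (t : ℕ) :
    excess (x ::ₘ s) t = (x - t) + excess s t := by
  simp [excess]

lemma excess_add (s s' : Multiset ℕ) (t : ℕ) : excess (s + s') t = excess s t + excess s' t := by
  simp [excess]

lemma excess_at_zero (s : Multiset ℕ) : excess s 0 = s.sum := by
  simp [excess]

/-- The second difference of `excess s` counts multiplicities. -/
lemma excess_add_excess (s : Multiset ℕ) (t : ℕ) :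
    excess s t + excess s (t + 2) = 2 * excess s (t + 1) + s.count (t + 1) := by
  induction s using Multiset.induction_on with
  | empty => simp
  | cons x s ih =>
    simp only [excess_cons, Multiset.count_cons]
    split_ifs <;> omega

lemma excess_eq_zero_of_sum_le (s : Multiset ℕ) (t : ℕ) (h : s.sum ≤ t) : excess s t = 0 := by
  induction s using Multiset.induction_on with
  | empty => simp
  | cons x s ih =>
    simp only [excess_cons, Multiset.sum_cons] at h ⊢
    have := ih (by omega)
    omega

lemma excess_add_mul_card (s : Multiset ℕ) (t : ℕ) (h : ∀ x ∈ s, t ≤ x) :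
    excess s t + t * s.card = s.sum := by
  induction s using Multiset.induction_on with
  | empty => simp
  | cons x s ih =>
    have hx := h x (by simp)
    have := ih fun y hy => h y (by simp [hy])
    simp only [excess_cons, Multiset.sum_cons, Multiset.card_cons, mul_add]
    omega

lemma excess_filter_pos (s : Multiset ℕ) (t : ℕ) :
    excess (s.filter (fun x => 0 < x)) t = excess s t := by
  induction s using Multiset.induction_on with
  | empty => simp
  | cons x s ih =>
    rcases Nat.eq_zero_or_pos x with rfl | hx
    · simp [ih]
    · simp [ih, hx]

lemma even_excess (s : Multiset ℕ) (t : ℕ) (hs : ∀ x ∈ s, Even x) (ht : Even t) :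
    Even (excess s t) := by
  induction s using Multiset.induction_on with
  | empty => simp
  | cons x s ih =>
    have hx := hs x (by simp)
    have := ih fun y hy => hs y (by simp [hy])
    simp only [excess_cons]
    rw [Nat.even_iff] at *
    omega

lemma eq_of_excess_eq {s s' : Multiset ℕ} (hs : PosParts s) (hs' : PosParts s')
    (h : ∀ t, excess s t = excess s' t) : s = s' := by
  ext x
  rcases x with _ | t
  · rw [Multiset.count_eq_zero_of_notMem fun h0 => (hs 0 h0).false,
      Multiset.count_eq_zero_of_notMem fun h0 => (hs' 0 h0).false]
  · have h1 := excess_add_excess s t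
    have h2 := excess_add_excess s' t
    rw [h, h, h] at h1
    omega

lemma coe_sortedDesc (s : Multiset ℕ) : (sortedDesc s : Multiset ℕ) = s := by
  rw [sortedDesc, Multiset.coe_reverse, Multiset.sort_eq]

lemma pairwise_sortedDesc (s : Multiset ℕ) : (sortedDesc s).Pairwise (· ≥ ·) := by
  rw [sortedDesc, List.pairwise_reverse]
  exact s.pairwise_sort (· ≤ ·)

lemma take_sum_le_excess_add_mul (L : List ℕ) (j t : ℕ) :
    (L.take j).sum ≤ excess L t + j * t := by
  induction L generalizing j with
  | nil => simp
  | cons x L ih =>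
    rcases j with _ | j
    · simp
    · have := ih j
      rw [← Multiset.cons_coe, excess_cons]
      simp only [List.take_succ_cons, List.sum_cons, add_mul, one_mul]
      omega

lemma exists_take_sum_eq (L : List ℕ) (hL : L.Pairwise (· ≥ ·)) (t : ℕ) :
    ∃ j, (L.take j).sum = excess L t + j * t := by
  induction L with
  | nil => exact ⟨0, by simp⟩
  | cons x L ih =>
    rw [List.pairwise_cons] at hL
    by_cases hx : t ≤ x
    · obtain ⟨j, hj⟩ := ih hL.2
      refine ⟨j + 1, ?_⟩
      rw [← Multiset.cons_coe, excess_cons]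
      simp only [List.take_succ_cons, List.sum_cons, add_mul, one_mul]
      omega
    · refine ⟨0, ?_⟩
      suffices excess (x :: L : List ℕ) t = 0 by simp [this]
      rw [excess, Multiset.sum_eq_zero_iff]
      simp only [Multiset.mem_map, Multiset.mem_coe, List.mem_cons]
      rintro _ ⟨y, rfl | hy, rfl⟩
      · omega
      · have := hL.1 y hy
        omega

lemma exists_excess_add_mul_eq (L : List ℕ) (hL : L.Pairwise (· ≥ ·)) (j : ℕ) :
    ∃ t, (∀ y, (∀ z ∈ L, z ≤ y) → t ≤ y) ∧ excess L t + j * t = (L.take j).sum := by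
  induction L generalizing j with
  | nil => exact ⟨0, by simp⟩
  | cons x L ih =>
    rw [List.pairwise_cons] at hL
    rcases j with _ | j
    · refine ⟨x, fun y hy => hy x (by simp), ?_⟩
      suffices excess (x :: L : List ℕ) x = 0 by simp [this]
      rw [excess, Multiset.sum_eq_zero_iff]
      simp only [Multiset.mem_map, Multiset.mem_coe, List.mem_cons]
      rintro _ ⟨y, rfl | hy, rfl⟩
      · omega
      · have := hL.1 y hy
        omega
    · obtain ⟨t, ht, hj⟩ := ih hL.2 j
      have hx : t ≤ x := ht x hL.1
      refine ⟨t, fun y hy => ht y fun z hz => hy z (by simp [hz]), ?_⟩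
      rw [← Multiset.cons_coe, excess_cons]
      simp only [List.take_succ_cons, List.sum_cons, add_mul, one_mul]
      omega

lemma domLE_iff_excess_le (a b : Multiset ℕ) : DomLE a b ↔ ∀ t, excess a t ≤ excess b t := by
  constructor
  · intro h t
    obtain ⟨j, hj⟩ := exists_take_sum_eq _ (pairwise_sortedDesc a) t
    have hb := take_sum_le_excess_add_mul (sortedDesc b) j t
    have hab := h j
    rw [coe_sortedDesc] at hj hb
    unfold psum at hab
    omega
  · intro h j
    obtain ⟨t, -, hj⟩ := exists_excess_add_mul_eq _ (pairwise_sortedDesc b) j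
    have ha := take_sum_le_excess_add_mul (sortedDesc a) j t
    have hab := h t
    rw [coe_sortedDesc] at hj ha
    unfold psum
    omega

lemma eq_of_second_difference_eq {f g : ℕ → ℕ} {c : ℕ → ℕ} (M : ℕ)
    (hf : ∀ t, f t + f (t + 2) = 2 * f (t + 1) + c t)
    (hg : ∀ t, g t + g (t + 2) = 2 * g (t + 1) + c t)
    (hfM : ∀ t, M ≤ t → f t = 0) (hgM : ∀ t, M ≤ t → g t = 0) (t : ℕ) : f t = g t := by
  suffices ∀ k t, M ≤ t + k → f t = g t from this M t (by omega)
  intro k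
  induction k using Nat.strong_induction_on with
  | _ k ih =>
    intro t ht
    rcases k with _ | k
    · rw [hfM t ht, hgM t ht]
    · have h1 := ih k (by omega) (t + 1) (by omega)
      have h2 := ih k (by omega) (t + 2) (by omega)
      have := hf t
      have := hg t
      omega

/-- Every convex eventually vanishing function is the excess function of a partition. -/
lemma exists_excess_eq (g : ℕ → ℕ) (M : ℕ) (hM : ∀ t, M ≤ t → g t = 0)
    (hg : ∀ t, 2 * g (t + 1) ≤ g t + g (t + 2)) :
    ∃ s : Multiset ℕ, PosParts s ∧ ∀ t, excess s t = g t := by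
  set c : ℕ → ℕ := fun t => g t + g (t + 2) - 2 * g (t + 1) with hc
  set s : Multiset ℕ := ∑ t ∈ Finset.range M, Multiset.replicate (c t) (t + 1) with hs
  have hmem : ∀ x ∈ s, 0 < x ∧ x ≤ M := by
    intro x hx
    rw [hs, Multiset.mem_sum] at hx
    obtain ⟨t, ht, hx⟩ := hx
    have := Multiset.eq_of_mem_replicate hx
    rw [Finset.mem_range] at ht
    omega
  have hcount : ∀ t, s.count (t + 1) = c t := by
    intro t
    rw [hs, Multiset.count_sum']
    simp only [Multiset.count_replicate, add_left_inj]
    rw [Finset.sum_ite_eq']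
    split_ifs with h
    · rfl
    · rw [Finset.mem_range, not_lt] at h
      simp [hc, hM t h, hM (t + 2) (by omega)]
  refine ⟨s, fun x hx => (hmem x hx).1, eq_of_second_difference_eq (c := c) M ?_ ?_ ?_ hM⟩
  · intro t
    rw [excess_add_excess, hcount]
  · intro t
    have := hg t
    simp only [hc]
    omega
  · intro t ht
    rw [excess, Multiset.sum_eq_zero_iff]
    simp only [Multiset.mem_map]
    rintro _ ⟨x, hx, rfl⟩
    have := hmem x hx
    omega

lemma IsTypeC.excess_mod_two {s : Multiset ℕ} (hs : IsTypeC s) (t : ℕ) (ht : t % 2 = 0) :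
    excess s t % 2 = 0 := by
  suffices ∀ k t, s.sum ≤ t + k → t % 2 = 0 → excess s t % 2 = 0 from this s.sum t (by omega) ht
  intro k
  induction k with
  | zero => intro t h _; rw [excess_eq_zero_of_sum_le s t h]
  | succ k ih =>
    intro t h ht
    have h2 := ih (t + 2) (by omega) (by omega)
    have hc := hs.2.2 (t + 1) (by rw [Nat.odd_iff]; omega)
    have := excess_add_excess s t
    rw [Nat.even_iff] at hc
    omega

lemma isTypeC_of_excess_mod_two {s : Multiset ℕ} (hs : PosParts s)
    (h : ∀ t, t % 2 = 0 → excess s t % 2 = 0) : IsTypeC s := by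
  refine ⟨hs, ?_, fun x hx => ?_⟩
  · rw [← excess_at_zero, Nat.even_iff]
    exact h 0 rfl
  · rw [Nat.odd_iff] at hx
    obtain ⟨t, rfl⟩ : ∃ t, x = t + 1 := ⟨x - 1, by omega⟩
    have h1 := h t (by omega)
    have h2 := h (t + 2) (by omega)
    have := excess_add_excess s t
    rw [Nat.even_iff]
    omega

/-- The largest convex function below a convex `f` taking even values at even arguments. -/
def evenFloor (f : ℕ → ℕ) (t : ℕ) : ℕ :=
  if t % 2 = 0 then 2 * (f t / 2) else min (f t) (f (t - 1) / 2 + f (t + 1) / 2)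

lemma evenFloor_of_even (f : ℕ → ℕ) {t : ℕ} (ht : t % 2 = 0) :
    evenFloor f t = 2 * (f t / 2) := if_pos ht

lemma evenFloor_succ_of_even (f : ℕ → ℕ) {t : ℕ} (ht : t % 2 = 0) :
    evenFloor f (t + 1) = min (f (t + 1)) (f t / 2 + f (t + 2) / 2) := by
  rw [evenFloor, if_neg (by omega)]
  rfl

lemma evenFloor_le (f : ℕ → ℕ) (t : ℕ) : evenFloor f t ≤ f t := by
  rw [evenFloor]
  split_ifs <;> omega

lemma evenFloor_convex {f : ℕ → ℕ} (hf : ∀ t, 2 * f (t + 1) ≤ f t + f (t + 2)) (t : ℕ) :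
    2 * evenFloor f (t + 1) ≤ evenFloor f t + evenFloor f (t + 2) := by
  rcases Nat.mod_two_eq_zero_or_one t with ht | ht
  · rw [evenFloor_of_even f ht, evenFloor_succ_of_even f ht,
      evenFloor_of_even f (t := t + 2) (by omega)]
    omega
  · obtain ⟨r, rfl⟩ : ∃ r, t = r + 1 := ⟨t - 1, by omega⟩
    have hr : r % 2 = 0 := by omega
    have h1 := evenFloor_succ_of_even f hr
    have h2 := evenFloor_of_even f (t := r + 2) (by omega)
    have h3 := evenFloor_succ_of_even f (t := r + 2) (by omega)
    have c1 := hf r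
    have c2 := hf (r + 1)
    have c3 := hf (r + 2)
    simp only [add_assoc, Nat.reduceAdd] at *
    omega

lemma IsCollapse.excess_eq_evenFloor {α β : Multiset ℕ} (h : IsCollapse IsTypeC α β) (t : ℕ) :
    excess β t = evenFloor (excess α) t := by
  obtain ⟨hβ, hsum, hle, hmax⟩ := h
  rw [domLE_iff_excess_le] at hle
  apply le_antisymm
  · have hev : ∀ t, t % 2 = 0 → excess β t ≤ 2 * (excess α t / 2) := by
      intro t ht
      have := hβ.excess_mod_two t ht
      have := hle t
      omega
    rcases Nat.mod_two_eq_zero_or_one t with ht | ht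
    · rw [evenFloor_of_even _ ht]
      exact hev t ht
    · obtain ⟨r, rfl⟩ : ∃ r, t = r + 1 := ⟨t - 1, by omega⟩
      rw [evenFloor_succ_of_even _ (by omega)]
      have := hev r (by omega)
      have := hev (r + 2) (by omega)
      have := excess_add_excess β r
      have := hle (r + 1)
      omega
  · obtain ⟨γ, hγ, hγe⟩ := exists_excess_eq (evenFloor (excess α)) α.sum
      (fun t ht => Nat.le_zero.1 <| (evenFloor_le _ t).trans
        (excess_eq_zero_of_sum_le α t ht).le)
      (evenFloor_convex fun t => by rw [excess_add_excess]; omega)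
    have hγC : IsTypeC γ := isTypeC_of_excess_mod_two hγ fun t ht => by
      rw [hγe, evenFloor_of_even _ ht]
      omega
    have hγsum : γ.sum = α.sum := by
      have := hβ.2.1
      rw [hsum, Nat.even_iff] at this
      rw [← excess_at_zero, hγe, evenFloor_of_even _ rfl, excess_at_zero]
      omega
    have := (domLE_iff_excess_le γ β).1 (hmax γ hγC hγsum
      ((domLE_iff_excess_le γ α).2 fun t => by rw [hγe]; exact evenFloor_le _ t)) t
    rwa [hγe] at this

lemma minPart_mem {s : Multiset ℕ} (hs : s ≠ 0) : minPart s ∈ s := by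
  have hlen : 0 < (s.sort (· ≤ ·)).length := by
    rw [Multiset.length_sort]
    exact Multiset.card_pos.2 hs
  rw [minPart, List.getD_eq_getElem _ _ hlen, ← Multiset.mem_sort (· ≤ ·)]
  exact List.getElem_mem hlen

lemma minPart_le {s : Multiset ℕ} {x : ℕ} (hx : x ∈ s) : minPart s ≤ x := by
  have h := s.pairwise_sort (· ≤ ·)
  rw [← Multiset.mem_sort (· ≤ ·)] at hx
  rw [minPart]
  cases hL : s.sort (· ≤ ·) with
  | nil => simp
  | cons y L =>
    rw [hL] at h hx
    rw [List.pairwise_cons] at h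
    rcases List.mem_cons.1 hx with rfl | hx
    · simp
    · simpa using h.1 x hx

lemma excess_decMin {s : Multiset ℕ} (hs : s ≠ 0) (t : ℕ) :
    excess (decMin s) t = excess s t - if t < minPart s then 1 else 0 := by
  rw [decMin, excess_filter_pos, excess_cons]
  have h := excess_cons (minPart s) (s.erase (minPart s)) t
  rw [Multiset.cons_erase (minPart_mem hs)] at h
  split_ifs <;> omega

lemma count_muEven (T : Multiset ℕ) (x : ℕ) : (muEven T).count x =
    if x ∈ T ∧ Even x then if Even (T.count x) then 2 else 1 else 0 := by
  rw [muEven, Multiset.count_bind]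
  simp only [Multiset.count_replicate]
  change ∑ y ∈ T.toFinset.filter (fun y => Even y), _ = _
  rw [Finset.sum_ite_eq']
  simp

lemma muEven_le (T : Multiset ℕ) : muEven T ≤ T := by
  rw [Multiset.le_iff_count]
  intro x
  rw [count_muEven]
  split_ifs with h h'
  · have := Multiset.count_pos.2 h.1
    rw [Nat.even_iff] at h'
    omega
  · exact Multiset.count_pos.2 h.1
  · omega

lemma even_of_mem_muEven {T : Multiset ℕ} {x : ℕ} (hx : x ∈ muEven T) : Even x := by
  rw [← Multiset.count_pos, count_muEven] at hx
  by_contra h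
  simp [h] at hx

/-- The C-collapse of `T⁻` splits off `muEven T`, for any nonempty partition `T`. -/
lemma collapse_decMin_eq_muEven_add {T d e : Multiset ℕ} (hpos : PosParts T) (hT : T ≠ 0)
    (hd : IsCollapse IsTypeC (decMin T) d)
    (he : IsCollapse IsTypeC (decMin (T - muEven T)) e) : d = muEven T + e := by
  set μ := muEven T with hμ
  set ν := T - μ with hν
  have hTsum : μ + ν = T := add_tsub_cancel_of_le (muEven_le T)
  have hadd : ∀ t, excess T t = excess μ t + excess ν t := fun t => by
    rw [← excess_add, hTsum]
  have hμev : ∀ t, t % 2 = 0 → excess μ t % 2 = 0 := fun t ht =>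
    Nat.even_iff.1 (even_excess μ t (fun x hx => even_of_mem_muEven hx) (Nat.even_iff.2 ht))
  have hTodd : excess T 0 % 2 = 1 := by
    have h1 := hd.1.2.1
    have h2 := hpos _ (minPart_mem hT)
    have h3 : excess T 0 ≠ 0 := by
      have := Multiset.single_le_sum (fun _ _ => Nat.zero_le _) _ (minPart_mem hT)
      rw [excess_at_zero]
      omega
    rw [hd.2.1, ← excess_at_zero, excess_decMin hT, if_pos h2, Nat.even_iff] at h1
    omega
  have hνodd : excess ν 0 % 2 = 1 := by
    have := hadd 0
    have := hμev 0 rfl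
    omega
  have hν0 : ν ≠ 0 := by
    intro h
    simp [h] at hνodd
  have hmin : minPart T ≤ minPart ν :=
    minPart_le (Multiset.mem_of_le (Multiset.sub_le_self _ _) (minPart_mem hν0))
  have hνlow : ∀ t, t % 2 = 0 → t ≤ minPart ν → excess ν t % 2 = 1 := by
    intro t ht htb
    have h := excess_add_mul_card ν t fun x hx => htb.trans (minPart_le hx)
    have : (t * ν.card) % 2 = 0 := by simp [Nat.mul_mod, ht]
    rw [excess_at_zero] at hνodd
    omega
  have hνpos : ∀ t, t < minPart ν → 0 < excess ν t := by
    intro t ht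
    have h := excess_cons (minPart ν) (ν.erase (minPart ν)) t
    rw [Multiset.cons_erase (minPart_mem hν0)] at h
    omega
  have hgap : ∀ t, t % 2 = 1 → minPart T ≤ t → t < minPart ν →
      minPart T < t ∧ ν.count t = 0 := by
    intro t ht hat htb
    have h1 : t ∉ ν := fun h => absurd (minPart_le h) (by omega)
    refine ⟨lt_of_le_of_ne hat ?_, Multiset.count_eq_zero_of_notMem h1⟩
    rintro rfl
    have h2 := minPart_mem hT
    rw [← hTsum, Multiset.mem_add] at h2
    rw [hTsum] at h2
    rcases h2 with h2 | h2
    · have := Nat.even_iff.1 (even_of_mem_muEven h2)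
      omega
    · exact h1 h2
  have hμodd : ∀ t, t % 2 = 1 → μ.count t = 0 := fun t ht =>
    Multiset.count_eq_zero_of_notMem fun h => by
      have := Nat.even_iff.1 (even_of_mem_muEven h)
      omega
  have heven : ∀ t, t % 2 = 0 →
      excess (decMin T) t / 2 = excess μ t / 2 + excess (decMin ν) t / 2 := by
    intro t ht
    rw [excess_decMin hT, excess_decMin hν0]
    have := hadd t
    have := hμev t ht
    have := hνlow t ht
    split_ifs <;> omega
  refine eq_of_excess_eq hd.1.1 ?_ fun t => ?_
  · intro x hx
    rcases Multiset.mem_add.1 hx with hx | hx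
    · exact hpos x (Multiset.mem_of_le (muEven_le T) hx)
    · exact he.1.1 x hx
  rw [excess_add, hd.excess_eq_evenFloor, he.excess_eq_evenFloor]
  rcases Nat.mod_two_eq_zero_or_one t with ht | ht
  · rw [evenFloor_of_even _ ht, evenFloor_of_even _ ht]
    have := heven t ht
    have := hμev t ht
    omega
  · obtain ⟨r, rfl⟩ : ∃ r, t = r + 1 := ⟨t - 1, by omega⟩
    rw [evenFloor_succ_of_even _ (by omega), evenFloor_succ_of_even _ (by omega)]
    have e1 := heven r (by omega)
    have e2 := heven (r + 2) (by omega)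
    have m1 := hμev r (by omega)
    have m2 := hμev (r + 2) (by omega)
    have m3 := excess_add_excess μ r
    rw [hμodd (r + 1) ht] at m3
    have n3 := excess_add_excess ν r
    have g := hgap (r + 1) ht
    have a1 := hadd (r + 1)
    have p1 := hνpos (r + 1)
    have l1 := hνlow r (by omega)
    have l2 := hνlow (r + 2) (by omega)
    have d1 := excess_decMin hT (r + 1)
    have d2 := excess_decMin hν0 (r + 1)
    have d3 := excess_decMin hν0 r
    have d4 := excess_decMin hν0 (r + 2)
    split_ifs at d1 d2 d3 d4 <;> omega

lemma part_one_mem {s : Multiset ℕ} (hs : s ≠ 0) : part s 1 ∈ s := by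
  have hlen : 0 < (sortedDesc s).length := by
    rw [← Multiset.coe_card, coe_sortedDesc]
    exact Multiset.card_pos.2 hs
  have h := List.getElem_mem hlen
  rw [← Multiset.mem_coe, coe_sortedDesc] at h
  rwa [part, List.getD_eq_getElem _ _ hlen]

lemma posParts_transpose (s : Multiset ℕ) : PosParts (transpose s) := by
  intro x hx
  obtain ⟨j, hj, rfl⟩ := Multiset.mem_map.1 hx
  rw [Multiset.mem_range] at hj
  have hs : s ≠ 0 := by
    rintro rfl
    simp [part, sortedDesc] at hj
  exact Multiset.card_pos_iff_exists_mem.2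
    ⟨part s 1, Multiset.mem_filter.2 ⟨part_one_mem hs, hj⟩⟩

lemma transpose_ne_zero {s : Multiset ℕ} (hpos : PosParts s) (hs : s ≠ 0) : transpose s ≠ 0 := by
  rw [← Multiset.card_pos, transpose, Multiset.card_map, Multiset.card_range]
  exact hpos _ (part_one_mem hs)

/-- For a B-partition `λ` of `n ≥ 1`, with `μ(λ)`, `ν(λ) = λᵗ ∖ μ(λ)`
and `d(λ) = ((λᵗ)⁻)_C`, one has `d(λ) = μ(λ) ∪ ((ν(λ))⁻)_C`. -/
theorem statement0 (n : ℕ) (hn : 1 ≤ n) (l : Multiset ℕ)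
    (hB : IsTypeB l ∧ l.sum = 2 * n + 1)
    (d e : Multiset ℕ)
    (hd : IsCollapse IsTypeC (decMin (transpose l)) d)
    (he : IsCollapse IsTypeC (decMin (transpose l - muEven (transpose l))) e) :
    d = muEven (transpose l) + e := by
  have hl : l ≠ 0 := by
    rintro rfl
    simp at hB
  exact collapse_decMin_eq_muEven_add (posParts_transpose l) (transpose_ne_zero hB.1.1 hl) hd he

end WFPaper
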